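/- arXiv:1210.7639 — 6 statements merged into one kernel-verified Lean document; each statement's English description precedes it below -/
import Mathlib

section
/- Let V : ℝ → ℝ be C³ with bounded second and third derivatives, and assume ∫_ℝ e^{-V(x)} dx < ∞. Then ∫_ℝ (V'(x))² e^{-V(x)} dx = ∫_ℝ V''(x) e^{-V(x)} dx, and this common value is finite. -/
open MeasureTheory

/-- An integrable nonnegative differentiable function has slope at most `1` at arbitrarily large
points. -/
lemma exists_ge_deriv_le_one_of_integrable {g g' : ℝ → ℝ} (hg : ∀ x, HasDerivAt g (g' x) x)
    (hpos : ∀ x, 0 ≤ g x) (hint : Integrable g) (B : ℝ) : ∃ b, B ≤ b ∧ g' b ≤ 1 := by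
  by_contra! h
  have hfin := hint.measure_norm_ge_lt_top one_pos
  have hsub : Set.Ici (B + 1) ⊆ {x | 1 ≤ ‖g x‖} := by
    intro x hx
    rw [Set.mem_Ici] at hx
    have hmvt := (convex_Ici B).mul_sub_le_image_sub_of_le_deriv (f := g) (C := 1)
      (fun y _ => (hg y).continuousAt.continuousWithinAt)
      (fun y _ => (hg y).differentiableAt.differentiableWithinAt)
      (fun y hy => by
        rw [(hg y).deriv]
        exact (h y (interior_subset hy)).le)
      B Set.self_mem_Ici x (by rw [Set.mem_Ici]; linarith) (by linarith)
    rw [Set.mem_ofPred_eq, Real.norm_of_nonneg (hpos x)]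
    linarith [hpos B]
  have htop := (measure_mono hsub).trans_lt hfin
  simp at htop

/-- An integrable nonnegative differentiable function has slope at least `-1` at arbitrarily
negative points. -/
lemma exists_le_neg_one_le_deriv_of_integrable {g g' : ℝ → ℝ} (hg : ∀ x, HasDerivAt g (g' x) x)
    (hpos : ∀ x, 0 ≤ g x) (hint : Integrable g) (A : ℝ) : ∃ a, a ≤ A ∧ -1 ≤ g' a := by
  obtain ⟨b, hb, hb'⟩ := exists_ge_deriv_le_one_of_integrable
    (g := fun x => g (-x)) (g' := fun x => -g' (-x))
    (fun x => ((hg (-x)).comp x (hasDerivAt_neg x)).congr_deriv (by ring))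
    (fun x => hpos (-x)) hint.comp_neg (-A)
  exact ⟨-b, by linarith, by linarith⟩

theorem stmt_0 (V : ℝ → ℝ) (hV : ContDiff ℝ 3 V)
    (C2 : ℝ) (hV2 : ∀ x, |iteratedDeriv 2 V x| ≤ C2)
    (C3 : ℝ) (hV3 : ∀ x, |iteratedDeriv 3 V x| ≤ C3)
    (hint : Integrable (fun x => Real.exp (-V x))) :
    Integrable (fun x => (deriv V x) ^ 2 * Real.exp (-V x)) ∧
    Integrable (fun x => iteratedDeriv 2 V x * Real.exp (-V x)) ∧
    ∫ x, (deriv V x) ^ 2 * Real.exp (-V x) = ∫ x, iteratedDeriv 2 V x * Real.exp (-V x) := by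
  have hcV : Continuous V := hV.continuous
  have hc1 : Continuous (deriv V) := hV.continuous_deriv (by norm_num)
  have hc2 : Continuous (iteratedDeriv 2 V) := hV.continuous_iteratedDeriv 2 (by norm_num)
  have hd1 (x : ℝ) : HasDerivAt V (deriv V x) x :=
    (hV.differentiable (by norm_num) x).hasDerivAt
  have hd2 (x : ℝ) : HasDerivAt (deriv V) (iteratedDeriv 2 V x) x := by
    have h := (hV.differentiable_iteratedDeriv 1 (by norm_num) x).hasDerivAt
    rwa [← iteratedDeriv_succ, iteratedDeriv_one] at h
  have hg (x : ℝ) : HasDerivAt (fun x => Real.exp (-V x)) (-(deriv V x * Real.exp (-V x))) x := by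
    exact (hd1 x).neg.exp.congr_deriv (by rw [Pi.neg_apply]; ring)
  have hF (x : ℝ) : HasDerivAt (fun x => deriv V x * Real.exp (-V x))
      (iteratedDeriv 2 V x * Real.exp (-V x) - deriv V x ^ 2 * Real.exp (-V x)) x := by
    exact ((hd2 x).mul (hg x)).congr_deriv (by ring)
  have hint2 : Integrable (fun x => iteratedDeriv 2 V x * Real.exp (-V x)) :=
    hint.bdd_mul (c := C2) hc2.aestronglyMeasurable (.of_forall hV2)
  have hcsq : Continuous fun x => deriv V x ^ 2 * Real.exp (-V x) := by fun_prop
  have hc2e : Continuous fun x => iteratedDeriv 2 V x * Real.exp (-V x) := by fun_prop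
  have hintsq : Integrable (fun x => deriv V x ^ 2 * Real.exp (-V x)) := by
    choose b hb hb' using fun n : ℕ =>
      exists_ge_deriv_le_one_of_integrable hg (fun x => (Real.exp_pos _).le) hint n
    choose a ha ha' using fun n : ℕ =>
      exists_le_neg_one_le_deriv_of_integrable hg (fun x => (Real.exp_pos _).le) hint (-n)
    refine integrable_of_intervalIntegral_norm_bounded (a := a) (b := b) (l := Filter.atTop)
      (2 + ∫ x, ‖iteratedDeriv 2 V x * Real.exp (-V x)‖)
      (fun n => hcsq.integrableOn_Ioc)
      (Filter.tendsto_atBot_mono ha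
        (Filter.tendsto_neg_atTop_atBot.comp tendsto_natCast_atTop_atTop))
      (Filter.tendsto_atTop_mono hb tendsto_natCast_atTop_atTop) (.of_forall fun n => ?_)
    have hab : a n ≤ b n := by linarith [ha n, hb n, n.cast_nonneg (α := ℝ)]
    have hnorm (x : ℝ) : ‖deriv V x ^ 2 * Real.exp (-V x)‖ = deriv V x ^ 2 * Real.exp (-V x) :=
      Real.norm_of_nonneg (by positivity)
    simp only [hnorm]
    have hftc := intervalIntegral.integral_eq_sub_of_hasDerivAt (a := a n) (b := b n)
      (fun x _ => hF x) ((hc2e.sub hcsq).intervalIntegrable _ _)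
    rw [intervalIntegral.integral_sub (hc2e.intervalIntegrable _ _)
      (hcsq.intervalIntegrable _ _)] at hftc
    have hle : ∫ x in a n..b n, iteratedDeriv 2 V x * Real.exp (-V x) ≤
        ∫ x, ‖iteratedDeriv 2 V x * Real.exp (-V x)‖ := by
      refine (Real.le_norm_self _).trans
        ((intervalIntegral.norm_integral_le_integral_norm hab).trans ?_)
      rw [intervalIntegral.integral_of_le hab]
      exact setIntegral_le_integral hint2.norm (.of_forall fun x => norm_nonneg _)
    linarith [ha' n, hb' n]
  refine ⟨hintsq, hint2, ?_⟩
  have hint1 : Integrable (fun x => deriv V x * Real.exp (-V x)) := by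
    refine (hint.add hintsq).mono' (by fun_prop) (.of_forall fun x => ?_)
    rw [norm_mul, Real.norm_of_nonneg (Real.exp_pos _).le, Real.norm_eq_abs, Pi.add_apply]
    have habs : |deriv V x| ≤ 1 + deriv V x ^ 2 := by
      nlinarith [sq_abs (deriv V x), sq_nonneg (|deriv V x| - 1), abs_nonneg (deriv V x)]
    nlinarith [Real.exp_pos (-V x)]
  have hzero := integral_eq_zero_of_hasDerivAt_of_integrable hF (hint2.sub hintsq) hint1
  rw [integral_sub hint2 hintsq] at hzero
  linarith
end

section
/- For all a ≥ 0 and b ∈ ℝ, one has 0 ≤ 𝒢(a,b) ≤ Γ(a,b) ≤ l². -/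
noncomputable def Phi (x : ℝ) : ℝ :=
  (Real.sqrt (2 * Real.pi))⁻¹ * ∫ y in Set.Iic x, Real.exp (-y ^ 2 / 2)

/-- The function `Γ` from the paper (depending on the parameter `l`). -/
noncomputable def Gam (l a b : ℝ) : ℝ :=
  if 0 < a then
    l ^ 2 * Phi (-(l * b) / (2 * Real.sqrt a))
      + l ^ 2 * Real.exp (l ^ 2 * (a - b) / 2) * Phi (l * (b / (2 * Real.sqrt a) - Real.sqrt a))
  else l ^ 2 * Real.exp (-(l ^ 2 * max b 0) / 2)

/-- The function `𝒢` from the paper (depending on the parameter `l`). -/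
noncomputable def Gcal (l a b : ℝ) : ℝ :=
  if 0 < a then
    l ^ 2 * Real.exp (l ^ 2 * (a - b) / 2) * Phi (l * (b / (2 * Real.sqrt a) - Real.sqrt a))
  else if 0 < b then l ^ 2 * Real.exp (-(l ^ 2 * b) / 2) else 0

open MeasureTheory Set

theorem integrable_exp_neg_sq_div_two : Integrable fun y : ℝ => Real.exp (-y ^ 2 / 2) := by
  refine (integrable_exp_neg_mul_sq (b := 1 / 2) (by norm_num)).congr (.of_forall fun y => ?_)
  ring_nf

theorem integral_exp_neg_sq_div_two :
    ∫ y : ℝ, Real.exp (-y ^ 2 / 2) = Real.sqrt (2 * Real.pi) := by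
  have h := integral_gaussian (1 / 2)
  rw [show Real.pi / (1 / 2) = 2 * Real.pi by ring] at h
  rw [← h]
  congr with y
  ring_nf

theorem Phi_nonneg (x : ℝ) : 0 ≤ Phi x :=
  mul_nonneg (by positivity) (integral_nonneg fun _ => (Real.exp_pos _).le)

theorem Phi_neg_add_Phi (x : ℝ) : Phi (-x) + Phi x = 1 := by
  have hneg : ∫ y in Iic (-x), Real.exp (-y ^ 2 / 2) = ∫ y in Ioi x, Real.exp (-y ^ 2 / 2) := by
    rw [← integral_comp_neg_Ioi x fun y => Real.exp (-y ^ 2 / 2)]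
    congr with y
    rw [neg_sq]
  have hsum := integral_add_compl (measurableSet_Iic (a := x)) integrable_exp_neg_sq_div_two
  rw [compl_Iic, integral_exp_neg_sq_div_two] at hsum
  rw [Phi, Phi, hneg, ← mul_add, add_comm, hsum]
  exact inv_mul_cancel₀ (by positivity)

/-- Exponential tilting: shifting the argument of `Phi` to the left by `s` gains the factor
`exp (s ^ 2 / 2 - u * s)`. -/
theorem exp_mul_Phi_sub_le {s : ℝ} (hs : 0 ≤ s) (u : ℝ) :
    Real.exp (s ^ 2 / 2 - u * s) * Phi (u - s) ≤ Phi u := by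
  have hshift : ∫ y in Iic (u - s), Real.exp (-y ^ 2 / 2)
      = ∫ z in Iic u, Real.exp (-(z - s) ^ 2 / 2) := by
    have h := (measurePreserving_sub_right volume s).setIntegral_preimage_emb
      (MeasurableEquiv.subRight s).measurableEmbedding
      (fun y => Real.exp (-y ^ 2 / 2)) (Iic (u - s))
    rw [← h]
    congr 2
    ext z
    simp
  rw [Phi, Phi, mul_left_comm, hshift, ← integral_const_mul]
  refine mul_le_mul_of_nonneg_left ?_ (by positivity)
  refine setIntegral_mono_on ?_ integrable_exp_neg_sq_div_two.integrableOn measurableSet_Iic ?_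
  · exact ((integrable_exp_neg_sq_div_two.comp_sub_right s).const_mul _).integrableOn
  · intro z hz
    rw [← Real.exp_add, Real.exp_le_exp]
    nlinarith [mul_nonneg hs (sub_nonneg.2 (mem_Iic.1 hz))]

theorem stmt_1 (l : ℝ) (hl : 0 < l) :
    ∀ a : ℝ, 0 ≤ a → ∀ b : ℝ,
      0 ≤ Gcal l a b ∧ Gcal l a b ≤ Gam l a b ∧ Gam l a b ≤ l ^ 2 := by
  intro a ha b
  unfold Gcal Gam
  split_ifs with ha' hb
  · refine ⟨mul_nonneg (by positivity) (Phi_nonneg _),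
      le_add_of_nonneg_left (mul_nonneg (by positivity) (Phi_nonneg _)), ?_⟩
    have hr : 0 < Real.sqrt a := Real.sqrt_pos.2 ha'
    have hsq : Real.sqrt a ^ 2 = a := Real.sq_sqrt ha
    have htilt := exp_mul_Phi_sub_le (mul_pos hl hr).le (l * b / (2 * Real.sqrt a))
    have hexp : (l * Real.sqrt a) ^ 2 / 2 - l * b / (2 * Real.sqrt a) * (l * Real.sqrt a)
        = l ^ 2 * (a - b) / 2 := by
      rw [mul_pow, hsq]
      field_simp
    have harg : l * b / (2 * Real.sqrt a) - l * Real.sqrt a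
        = l * (b / (2 * Real.sqrt a) - Real.sqrt a) := by ring
    rw [hexp, harg] at htilt
    have hone := Phi_neg_add_Phi (l * b / (2 * Real.sqrt a))
    rw [neg_div, mul_assoc, ← mul_add]
    exact mul_le_of_le_one_right (by positivity) (by linarith)
  · rw [max_eq_left hb.le]
    refine ⟨by positivity, le_rfl, mul_le_of_le_one_right (by positivity) ?_⟩
    rw [Real.exp_le_one_iff]
    have : 0 ≤ l ^ 2 * b := by positivity
    linarith
  · rw [max_eq_right (not_lt.1 hb)]
    refine ⟨le_rfl, by positivity, by simp⟩
end

section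
/- The function 𝒢 is continuous at every point (0, β) with β ≠ 0: for all sequences aₙ > 0 with aₙ → 0 and bₙ → β, one has 𝒢(aₙ, bₙ) → 𝒢(0, β), where 𝒢(0,β) = l²·exp(−l²·β/2) if β > 0 and 𝒢(0,β) = 0 if β < 0. -/
open Filter Topology MeasureTheory ProbabilityTheory

theorem Phi_eq_cdf_gaussianReal (x : ℝ) : Phi x = cdf (gaussianReal 0 1) x := by
  rw [cdf_eq_real, measureReal_def, gaussianReal_apply_eq_integral 0 one_ne_zero,
    ENNReal.toReal_ofReal (integral_nonneg fun y => gaussianPDFReal_nonneg 0 1 y), Phi,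
    ← integral_const_mul]
  simp [gaussianPDFReal]

theorem tendsto_Phi_atTop : Tendsto Phi atTop (𝓝 1) := by
  simpa only [funext Phi_eq_cdf_gaussianReal] using tendsto_cdf_atTop (gaussianReal 0 1)

theorem tendsto_Phi_atBot : Tendsto Phi atBot (𝓝 0) := by
  simpa only [funext Phi_eq_cdf_gaussianReal] using tendsto_cdf_atBot (gaussianReal 0 1)

theorem stmt_7 (l : ℝ) (hl : 0 < l) (β : ℝ) (hβ : β ≠ 0) (a b : ℕ → ℝ)
    (ha : ∀ n, 0 < a n)
    (ha0 : Filter.Tendsto a Filter.atTop (nhds 0))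
    (hb : Filter.Tendsto b Filter.atTop (nhds β)) :
    Filter.Tendsto (fun n => Gcal l (a n) (b n)) Filter.atTop (nhds (Gcal l 0 β)) := by
  have hsqrt : Tendsto (fun n => √(a n)) atTop (𝓝 0) := by simpa using ha0.sqrt
  have hinv : Tendsto (fun n => (2 * √(a n))⁻¹) atTop atTop := by
    refine Tendsto.inv_tendsto_nhdsGT_zero (tendsto_nhdsWithin_iff.2 ⟨?_, ?_⟩)
    · simpa using hsqrt.const_mul 2
    · exact Eventually.of_forall fun n => mul_pos two_pos (Real.sqrt_pos.2 (ha n))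
  have hexp : Tendsto (fun n => l ^ 2 * Real.exp (l ^ 2 * (a n - b n) / 2)) atTop
      (𝓝 (l ^ 2 * Real.exp (-(l ^ 2 * β) / 2))) := by
    have h := ((((ha0.sub hb).const_mul (l ^ 2)).div_const 2).rexp).const_mul (l ^ 2)
    simpa using h
  simp only [Gcal, ha, if_true, lt_irrefl, if_false]
  rcases hβ.lt_or_gt with hneg | hpos
  · have harg : Tendsto (fun n => l * (b n / (2 * √(a n)) - √(a n))) atTop atBot :=
      ((hb.neg_mul_atTop hneg hinv).atBot_add hsqrt.neg).const_mul_atBot hl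
    simpa [hneg.not_gt] using hexp.mul (tendsto_Phi_atBot.comp harg)
  · have harg : Tendsto (fun n => l * (b n / (2 * √(a n)) - √(a n))) atTop atTop :=
      ((hb.pos_mul_atTop hpos hinv).atTop_add hsqrt.neg).const_mul_atTop hl
    simpa [hpos] using hexp.mul (tendsto_Phi_atTop.comp harg)
end

section
/- Let G and G̃ be independent standard normal random variables and let α, β, γ ∈ ℝ with α² + β² > 0. Then | E[ G·( max( 1 − exp(αG + βG̃ + γ), 0 ) ) ] | ≤ ( √(2/π) + √(2·max(−γ,0)) ) · √( α²/(α² + β²) ). -/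
open MeasureTheory ProbabilityTheory

/-- A centred square-integrable variable correlates with a `[0, 1]`-valued one by at most half its
`L²` norm. -/
lemma abs_integral_mul_le_half_sqrt {Ω : Type*} [MeasurableSpace Ω] {P : Measure Ω}
    [IsProbabilityMeasure P] {X f : Ω → ℝ} (hX : MemLp X 2 P) (hX0 : ∫ ω, X ω ∂P = 0)
    (hf : AEStronglyMeasurable f P) (hf0 : ∀ ω, 0 ≤ f ω) (hf1 : ∀ ω, f ω ≤ 1) :
    |∫ ω, X ω * f ω ∂P| ≤ √(∫ ω, X ω ^ 2 ∂P) / 2 := by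
  have hXi : Integrable X P := hX.integrable one_le_two
  have hXf : Integrable (fun ω ↦ X ω * f ω) P :=
    hXi.mul_bdd (c := 1) hf (ae_of_all _ fun ω ↦ by
      rw [Real.norm_eq_abs, abs_of_nonneg (hf0 ω)]; exact hf1 ω)
  have hcenter : ∫ ω, X ω * f ω ∂P = ∫ ω, X ω * (f ω - 1 / 2) ∂P := by
    simp_rw [mul_sub]
    rw [integral_sub hXf (hXi.mul_const _), integral_mul_const, hX0]
    simp
  have habs : |∫ ω, X ω * f ω ∂P| ≤ (∫ ω, |X ω| ∂P) / 2 := by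
    rw [hcenter, ← integral_div]
    refine (abs_integral_le_integral_abs).trans (integral_mono_of_nonneg
      (ae_of_all _ fun ω ↦ abs_nonneg _) (hXi.abs.div_const 2) (ae_of_all _ fun ω ↦ ?_))
    have : |f ω - 1 / 2| ≤ 1 / 2 := abs_le.2 ⟨by linarith [hf0 ω], by linarith [hf1 ω]⟩
    simp only [abs_mul]
    nlinarith [abs_nonneg (X ω)]
  have hvar : 0 ≤ Var[|X|; P] := variance_nonneg _ _
  rw [variance_eq_sub hX.abs] at hvar
  have : ∫ ω, |X ω| ∂P ≤ √(∫ ω, X ω ^ 2 ∂P) := by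
    apply Real.le_sqrt_of_sq_le
    simpa using hvar
  linarith

/-- Rotating a pair of independent Gaussians of equal variance, up to scaling, yields an
independent pair. -/
lemma ProbabilityTheory.IndepFun.rotate_gaussian {Ω : Type*} [MeasurableSpace Ω] {P : Measure Ω}
    {X Y : Ω → ℝ} (hX : HasGaussianLaw X P) (hY : HasGaussianLaw Y P) (hXY : IndepFun X Y P)
    (hvar : Var[X; P] = Var[Y; P]) (a b : ℝ) :
    IndepFun (fun ω ↦ a * X ω + b * Y ω) (fun ω ↦ b * X ω - a * Y ω) P := by
  have := hX.isProbabilityMeasure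
  have hX2 := hX.memLp_two
  have hY2 := hY.memLp_two
  let L : ℝ × ℝ →L[ℝ] ℝ × ℝ :=
    (a • ContinuousLinearMap.fst ℝ ℝ ℝ + b • ContinuousLinearMap.snd ℝ ℝ ℝ).prod
      (b • ContinuousLinearMap.fst ℝ ℝ ℝ - a • ContinuousLinearMap.snd ℝ ℝ ℝ)
  have hlaw : HasGaussianLaw (fun ω ↦ (a * X ω + b * Y ω, b * X ω - a * Y ω)) P :=
    (hXY.hasGaussianLaw hX hY).map_fun L
  refine hlaw.indepFun_of_covariance_eq_zero ?_
  change cov[a • X + b • Y, b • X - a • Y; P] = 0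
  rw [covariance_add_left (hX2.const_smul a) (hY2.const_smul b)
      ((hX2.const_smul b).sub (hY2.const_smul a)),
    covariance_sub_right (hX2.const_smul a) (hX2.const_smul b) (hY2.const_smul a),
    covariance_sub_right (hY2.const_smul b) (hX2.const_smul b) (hY2.const_smul a)]
  simp only [covariance_smul_left, covariance_smul_right, covariance_comm Y X,
    hXY.covariance_eq_zero hX2 hY2, covariance_self hX.aemeasurable, covariance_self hY.aemeasurable,
    hvar]
  ring

theorem stmt_9 {Ω : Type*} [MeasureSpace Ω] [IsProbabilityMeasure (ℙ : Measure Ω)]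
    (G Gt : Ω → ℝ)
    (hG : Measure.map G ℙ = gaussianReal 0 1)
    (hGt : Measure.map Gt ℙ = gaussianReal 0 1)
    (hind : IndepFun G Gt ℙ)
    (α β γ : ℝ) (h : 0 < α ^ 2 + β ^ 2) :
    |∫ ω, G ω * max (1 - Real.exp (α * G ω + β * Gt ω + γ)) 0 ∂ℙ| ≤
      (Real.sqrt (2 / Real.pi) + Real.sqrt (2 * max (-γ) 0)) *
        Real.sqrt (α ^ 2 / (α ^ 2 + β ^ 2)) := by
  have hlaw : ∀ {Z : Ω → ℝ}, Measure.map Z ℙ = gaussianReal 0 1 →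
      HasGaussianLaw Z ℙ ∧ ∫ ω, Z ω = 0 ∧ Var[Z; ℙ] = 1 := by
    intro Z hZ
    have hg : HasGaussianLaw Z ℙ := ⟨hZ ▸ inferInstance⟩
    refine ⟨hg, ?_, ?_⟩
    · rw [← integral_id_gaussianReal (μ := 0) (v := 1), ← hZ, integral_map hg.aemeasurable]
      fun_prop
    · rw [← variance_id_map hg.aemeasurable, hZ, variance_id_gaussianReal]
      rfl
  obtain ⟨hGl, hG0, hG1⟩ := hlaw hG
  obtain ⟨hGtl, hGt0, hGt1⟩ := hlaw hGt
  set X : Ω → ℝ := fun ω ↦ α * G ω + β * Gt ω with hXdef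
  set Y : Ω → ℝ := fun ω ↦ β * G ω - α * Gt ω with hYdef
  have hXY : IndepFun X Y ℙ := hind.rotate_gaussian hGl hGtl (hG1.trans hGt1.symm) α β
  have hGi := hGl.integrable
  have hGti := hGtl.integrable
  have hX2 : MemLp X 2 ℙ := (hGl.memLp_two.const_mul α).add (hGtl.memLp_two.const_mul β)
  have hX0 : ∫ ω, X ω = 0 := by
    rw [integral_add (hGi.const_mul α) (hGti.const_mul β), integral_const_mul, integral_const_mul,
      hG0, hGt0]
    simp
  have hYi : Integrable Y ℙ := (hGi.const_mul β).sub (hGti.const_mul α)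
  have hY0 : ∫ ω, Y ω = 0 := by
    rw [integral_sub (hGi.const_mul β) (hGti.const_mul α), integral_const_mul, integral_const_mul,
      hG0, hGt0]
    simp
  have hXsq : ∫ ω, X ω ^ 2 = α ^ 2 + β ^ 2 := by
    rw [← variance_of_integral_eq_zero hX2.aestronglyMeasurable.aemeasurable hX0]
    change Var[α • G + β • Gt; ℙ] = _
    rw [IndepFun.variance_add (hGl.memLp_two.const_smul α) (hGtl.memLp_two.const_smul β)
      (hind.comp (measurable_const_mul α) (measurable_const_mul β)), variance_smul, variance_smul,
      hG1, hGt1]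
    ring
  let φ : ℝ → ℝ := fun x ↦ max (1 - Real.exp (x + γ)) 0
  have hφ : Measurable φ := by fun_prop
  have hφ0 : ∀ x, 0 ≤ φ x := fun x ↦ le_max_right _ _
  have hφ1 : ∀ x, φ x ≤ 1 := fun x ↦ max_le (by linarith [Real.exp_pos (x + γ)]) zero_le_one
  have hfm : AEStronglyMeasurable (fun ω ↦ φ (X ω)) ℙ :=
    (hφ.comp_aemeasurable hX2.aestronglyMeasurable.aemeasurable).aestronglyMeasurable
  have hbdd : ∀ᵐ ω ∂(ℙ : Measure Ω), ‖φ (X ω)‖ ≤ 1 := ae_of_all _ fun ω ↦ by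
    rw [Real.norm_eq_abs, abs_of_nonneg (hφ0 _)]; exact hφ1 _
  have hYf : ∫ ω, Y ω * φ (X ω) = 0 := by
    have hYφ : IndepFun Y (fun ω ↦ φ (X ω)) ℙ := hXY.symm.comp measurable_id hφ
    rw [hYφ.integral_fun_mul_eq_mul_integral hYi.aestronglyMeasurable hfm, hY0, zero_mul]
  have hdecomp : (α ^ 2 + β ^ 2) * ∫ ω, G ω * φ (X ω) = α * ∫ ω, X ω * φ (X ω) := by
    have hsplit : ∀ ω, (α ^ 2 + β ^ 2) * (G ω * φ (X ω))
        = α * (X ω * φ (X ω)) + β * (Y ω * φ (X ω)) := fun ω ↦ by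
      simp only [hXdef, hYdef]; ring
    rw [← integral_const_mul, integral_congr_ae (ae_of_all _ hsplit),
      integral_add (((hX2.integrable one_le_two).mul_bdd (c := 1) hfm hbdd).const_mul α)
        ((hYi.mul_bdd (c := 1) hfm hbdd).const_mul β), integral_const_mul, integral_const_mul, hYf]
    simp
  have hbound := abs_integral_mul_le_half_sqrt hX2 hX0 hfm (fun ω ↦ hφ0 _) (fun ω ↦ hφ1 _)
  rw [hXsq] at hbound
  have hpi : 1 / 2 ≤ √(2 / Real.pi) := by
    apply Real.le_sqrt_of_sq_le
    rw [le_div_iff₀ Real.pi_pos]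
    linarith [Real.pi_le_four]
  have hs : 0 < √(α ^ 2 + β ^ 2) := Real.sqrt_pos.2 h
  have hfinal : |∫ ω, G ω * φ (X ω)| ≤ 1 / 2 * (|α| / √(α ^ 2 + β ^ 2)) := by
    have hI : ∫ ω, G ω * φ (X ω) = α * (∫ ω, X ω * φ (X ω)) / (α ^ 2 + β ^ 2) := by
      rw [← hdecomp]; field_simp
    rw [hI, abs_div, abs_mul, abs_of_pos h, div_le_iff₀ h]
    calc |α| * |∫ ω, X ω * φ (X ω)| ≤ |α| * (√(α ^ 2 + β ^ 2) / 2) := by gcongr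
      _ = 1 / 2 * (|α| / √(α ^ 2 + β ^ 2)) * √(α ^ 2 + β ^ 2) ^ 2 := by field_simp
      _ = _ := by rw [Real.sq_sqrt h.le]
  rw [Real.sqrt_div (sq_nonneg α), Real.sqrt_sq_eq_abs]
  refine hfinal.trans (mul_le_mul_of_nonneg_right ?_ (by positivity))
  linarith [Real.sqrt_nonneg (2 * max (-γ) 0)]
end

section
/- Let G and G̃ be independent standard normal random variables and let α, β, γ ∈ ℝ with s := α² + β² > 0. Then E[ G²·( min( exp(αG + βG̃ + γ), 1) ) ] = (1 + α²)·exp(γ + s/2)·Φ( −(γ + s)/√s ) + Φ( γ/√s ) − ( α²/√(2π·s) )·exp( −γ²/(2s) ). -/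
open MeasureTheory ProbabilityTheory

lemma exp_mul_sub_sq_half (r x : ℝ) :
    Real.exp (r * x - x ^ 2 / 2) = Real.exp (r ^ 2 / 2) * Real.exp (-(x - r) ^ 2 / 2) := by
  rw [← Real.exp_add]
  ring_nf

lemma integrable_pow_mul_exp_neg_sq_half (n : ℕ) :
    Integrable fun x : ℝ ↦ x ^ n * Real.exp (-x ^ 2 / 2) := by
  have h := integrable_rpow_mul_exp_neg_mul_sq (b := 1 / 2) (by norm_num) (s := n)
    (by linarith [n.cast_nonneg (α := ℝ)])
  refine h.congr (ae_of_all _ fun x ↦ ?_)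
  simp only [Real.rpow_natCast]
  ring_nf

lemma integrable_pow_mul_exp_mul_sub_sq_half (r : ℝ) (n : ℕ) :
    Integrable fun x : ℝ ↦ x ^ n * Real.exp (r * x - x ^ 2 / 2) := by
  have key : ∀ k : ℕ,
      Integrable fun y : ℝ ↦ y ^ k * (y + r) ^ n * Real.exp (-y ^ 2 / 2) := by
    induction n with
    | zero => simpa using integrable_pow_mul_exp_neg_sq_half
    | succ n ih =>
      intro k
      refine ((ih (k + 1)).add ((ih k).const_mul r)).congr (ae_of_all _ fun y ↦ ?_)
      simp only [Pi.add_apply]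
      ring
  refine (((key 0).comp_sub_right r).const_mul (Real.exp (r ^ 2 / 2))).congr
    (ae_of_all _ fun x ↦ ?_)
  simp only [exp_mul_sub_sq_half, pow_zero, sub_add_cancel]
  ring

/-- Completing the square in an exponentially tilted Gaussian integral. -/
lemma setIntegral_Iic_exp_mul_sub_sq_half (r a : ℝ) :
    ∫ x in Set.Iic a, Real.exp (r * x - x ^ 2 / 2) =
      Real.exp (r ^ 2 / 2) * ∫ y in Set.Iic (a - r), Real.exp (-y ^ 2 / 2) := by
  rw [← (measurePreserving_sub_right volume r).setIntegral_preimage_emb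
    (measurableEmbedding_subRight r) (fun y ↦ Real.exp (-y ^ 2 / 2)), ← integral_const_mul]
  simp [exp_mul_sub_sq_half]

/-- Integration by parts for the second moment of a truncated tilted Gaussian. -/
lemma setIntegral_Iic_sq_mul_exp_mul_sub_sq_half (r a : ℝ) :
    ∫ x in Set.Iic a, x ^ 2 * Real.exp (r * x - x ^ 2 / 2) =
      (1 + r ^ 2) * (∫ x in Set.Iic a, Real.exp (r * x - x ^ 2 / 2))
        - (a + r) * Real.exp (r * a - a ^ 2 / 2) := by
  have h0 := integrable_pow_mul_exp_mul_sub_sq_half r 0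
  have h1 := integrable_pow_mul_exp_mul_sub_sq_half r 1
  have h2 := integrable_pow_mul_exp_mul_sub_sq_half r 2
  simp only [pow_zero, one_mul, pow_one] at h0 h1
  have hderiv (x : ℝ) : HasDerivAt (fun x ↦ -((x + r) * Real.exp (r * x - x ^ 2 / 2)))
      (x ^ 2 * Real.exp (r * x - x ^ 2 / 2)
        - (1 + r ^ 2) * Real.exp (r * x - x ^ 2 / 2)) x := by
    have hexp : HasDerivAt (fun x : ℝ ↦ r * x - x ^ 2 / 2) (r - x) x := by
      refine (((hasDerivAt_id x).const_mul r).sub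
        (((hasDerivAt_id x).pow 2).div_const 2)).congr_deriv ?_
      simp
    refine (((hasDerivAt_id x).add_const r).mul hexp.exp).neg.congr_deriv ?_
    simp only [id_eq]
    ring
  have hint := h2.sub (h0.const_mul (1 + r ^ 2))
  have hprim : Integrable fun x : ℝ ↦ -((x + r) * Real.exp (r * x - x ^ 2 / 2)) := by
    refine (h1.add (h0.const_mul r)).neg.congr (ae_of_all _ fun x ↦ ?_)
    simp only [Pi.neg_apply, Pi.add_apply]
    ring
  have hlim := tendsto_zero_of_hasDerivAt_of_integrableOn_Iic (a := a)
    (fun x _ ↦ hderiv x) hint.integrableOn hprim.integrableOn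
  have := integral_Iic_of_hasDerivAt_of_tendsto' (a := a) (fun x _ ↦ hderiv x)
    hint.integrableOn hlim
  rw [integral_sub h2.integrableOn (h0.const_mul _).integrableOn, integral_const_mul] at this
  linarith

lemma norm_min_exp_one_le (t : ℝ) : ‖min (Real.exp t) 1‖ ≤ 1 := by
  rw [Real.norm_of_nonneg (by positivity)]
  exact min_le_right _ _

lemma integrable_pow_gaussianReal (n : ℕ) :
    Integrable (fun x ↦ x ^ n) (gaussianReal 0 1) :=
  integrable_pow_of_mem_interior_integrableExpSet (by simp) n

lemma integrable_pow_mul_min_exp_gaussianReal (r c : ℝ) (n : ℕ) :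
    Integrable (fun x ↦ x ^ n * min (Real.exp (r * x + c)) 1) (gaussianReal 0 1) :=
  (integrable_pow_gaussianReal n).mul_bdd (c := 1) (by fun_prop)
    (ae_of_all _ fun x ↦ norm_min_exp_one_le _)

/-- Splitting a truncated exponential moment of a standard Gaussian at the kink of
`min (exp ·) 1`. -/
lemma integral_pow_mul_min_exp_gaussianReal {r : ℝ} (hr : 0 < r) (c : ℝ) (n : ℕ) :
    ∫ x, x ^ n * min (Real.exp (r * x + c)) 1 ∂gaussianReal 0 1 =
      (Real.sqrt (2 * Real.pi))⁻¹ *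
        (Real.exp c * (∫ x in Set.Iic (-(c / r)), x ^ n * Real.exp (r * x - x ^ 2 / 2))
          + ∫ x in Set.Iic (c / r), (-x) ^ n * Real.exp (-x ^ 2 / 2)) := by
  have hint : Integrable fun x : ℝ ↦
      (x ^ n * Real.exp (-x ^ 2 / 2)) * min (Real.exp (r * x + c)) 1 :=
    (integrable_pow_mul_exp_neg_sq_half n).mul_bdd (c := 1) (by fun_prop)
      (ae_of_all _ fun x ↦ norm_min_exp_one_le _)
  rw [integral_gaussianReal_eq_integral_smul one_ne_zero]
  calc
    _ = ∫ x : ℝ, (Real.sqrt (2 * Real.pi))⁻¹ *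
        ((x ^ n * Real.exp (-x ^ 2 / 2)) * min (Real.exp (r * x + c)) 1) := by
      congr with x
      simp [gaussianPDFReal_def]
      ring
    _ = _ := by
      rw [integral_const_mul, ← intervalIntegral.integral_Iic_add_Ioi (b := -(c / r))
        hint.integrableOn hint.integrableOn, ← integral_const_mul]
      congr 2
      · refine setIntegral_congr_fun measurableSet_Iic fun x hx ↦ ?_
        have hle : r * x + c ≤ 0 := by
          have := mul_le_mul_of_nonneg_left (Set.mem_Iic.mp hx) hr.le
          rw [mul_neg, mul_div_cancel₀ _ hr.ne'] at this
          linarith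
        have hexp : Real.exp (-x ^ 2 / 2) * Real.exp (r * x + c) =
            Real.exp c * Real.exp (r * x - x ^ 2 / 2) := by
          rw [← Real.exp_add, ← Real.exp_add]
          ring_nf
        simp only [min_eq_left (Real.exp_le_one_iff.mpr hle), mul_assoc, hexp]
        ring
      · rw [← integral_comp_neg_Iic]
        refine setIntegral_congr_fun measurableSet_Iic fun x hx ↦ ?_
        have hle : 0 ≤ r * -x + c := by
          have := mul_le_mul_of_nonneg_left (Set.mem_Iic.mp hx) hr.le
          rw [mul_div_cancel₀ _ hr.ne'] at this
          linarith
        simp only [min_eq_right (Real.one_le_exp hle), neg_sq, mul_one]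

lemma exp_mul_setIntegral_Iic_neg_div {r : ℝ} (hr : 0 < r) (c : ℝ) :
    Real.exp c * (∫ x in Set.Iic (-(c / r)), Real.exp (r * x - x ^ 2 / 2)) =
      Real.exp (c + r ^ 2 / 2) * ∫ y in Set.Iic (-(c + r ^ 2) / r), Real.exp (-y ^ 2 / 2) := by
  rw [setIntegral_Iic_exp_mul_sub_sq_half, Real.exp_add, mul_assoc]
  congr 5
  field_simp
  ring

lemma integral_min_exp_gaussianReal {r : ℝ} (hr : 0 < r) (c : ℝ) :
    ∫ x, min (Real.exp (r * x + c)) 1 ∂gaussianReal 0 1 =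
      Real.exp (c + r ^ 2 / 2) * Phi (-(c + r ^ 2) / r) + Phi (c / r) := by
  have h := integral_pow_mul_min_exp_gaussianReal hr c 0
  simp only [pow_zero, one_mul] at h
  rw [h, exp_mul_setIntegral_Iic_neg_div hr, Phi, Phi]
  ring

lemma integral_sq_mul_min_exp_gaussianReal {r : ℝ} (hr : 0 < r) (c : ℝ) :
    ∫ x, x ^ 2 * min (Real.exp (r * x + c)) 1 ∂gaussianReal 0 1 =
      (1 + r ^ 2) * Real.exp (c + r ^ 2 / 2) * Phi (-(c + r ^ 2) / r) + Phi (c / r)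
        - r * (Real.sqrt (2 * Real.pi))⁻¹ * Real.exp (-(c / r) ^ 2 / 2) := by
  have htop := setIntegral_Iic_sq_mul_exp_mul_sub_sq_half 0 (c / r)
  simp only [zero_mul, zero_sub, ← neg_div] at htop
  have hbdry : Real.exp c * Real.exp (r * -(c / r) - (-(c / r)) ^ 2 / 2) =
      Real.exp (-(c / r) ^ 2 / 2) := by
    rw [← Real.exp_add, mul_neg, mul_div_cancel₀ _ hr.ne']
    ring_nf
  rw [integral_pow_mul_min_exp_gaussianReal hr, setIntegral_Iic_sq_mul_exp_mul_sub_sq_half,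
    mul_sub, mul_left_comm, exp_mul_setIntegral_Iic_neg_div hr, mul_left_comm (Real.exp c), hbdry]
  simp only [neg_sq]
  rw [htop, Phi, Phi]
  ring

/-- Rotation invariance reduces a quadratic moment against a function of a linear combination of
two independent standard Gaussians to one-dimensional moments. -/
lemma integral_sq_mul_min_exp_gaussianReal_prod (r θ c : ℝ) :
    ∫ z : ℝ × ℝ, z.1 ^ 2 *
        min (Real.exp (r * Real.cos θ * z.1 - r * Real.sin θ * z.2 + c)) 1
        ∂(gaussianReal 0 1).prod (gaussianReal 0 1) =
      Real.cos θ ^ 2 * (∫ x, x ^ 2 * min (Real.exp (r * x + c)) 1 ∂gaussianReal 0 1)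
        + Real.sin θ ^ 2 * ∫ x, min (Real.exp (r * x + c)) 1 ∂gaussianReal 0 1 := by
  have hsq : ∫ y, y ^ 2 ∂gaussianReal 0 1 = 1 := by
    have := variance_fun_id_gaussianReal (μ := 0) (v := 1)
    rw [variance_eq_integral (by fun_prop)] at this
    simpa [integral_id_gaussianReal] using this
  have hterm (n : ℕ) := (integrable_pow_mul_min_exp_gaussianReal r c n).mul_prod
    (integrable_pow_gaussianReal (2 - n))
  have hprod (n m : ℕ) := integral_prod_mul (μ := gaussianReal 0 1) (ν := gaussianReal 0 1)
    (fun x : ℝ ↦ x ^ n * min (Real.exp (r * x + c)) 1) (fun y : ℝ ↦ y ^ m)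
  rw [← IsGaussian.map_rotation_eq_self (μ := gaussianReal 0 1) (by simp) θ,
    integral_map (by fun_prop) (by fun_prop)]
  calc
    _ = ∫ z : ℝ × ℝ,
        (Real.cos θ ^ 2 * (z.1 ^ 2 * min (Real.exp (r * z.1 + c)) 1 * z.2 ^ (2 - 2))
        + 2 * Real.cos θ * Real.sin θ *
          (z.1 ^ 1 * min (Real.exp (r * z.1 + c)) 1 * z.2 ^ (2 - 1))
        + Real.sin θ ^ 2 * (z.1 ^ 0 * min (Real.exp (r * z.1 + c)) 1 * z.2 ^ (2 - 0)))
        ∂(gaussianReal 0 1).prod (gaussianReal 0 1) := by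
      congr with z
      have harg : r * Real.cos θ * (Real.cos θ * z.1 + Real.sin θ * z.2)
          - r * Real.sin θ * (-Real.sin θ * z.1 + Real.cos θ * z.2) + c = r * z.1 + c := by
        linear_combination r * z.1 * Real.cos_sq_add_sin_sq θ
      simp only [ContinuousLinearMap.rotation_apply, smul_eq_mul, harg]
      ring
    _ = _ := by
      rw [integral_add (by exact ((hterm 2).const_mul _).add ((hterm 1).const_mul _))
          ((hterm 0).const_mul _),
        integral_add ((hterm 2).const_mul _) ((hterm 1).const_mul _),
        integral_const_mul, integral_const_mul, integral_const_mul]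
      simp only [hprod]
      simp [hsq, integral_id_gaussianReal]

theorem stmt_10 {Ω : Type*} [MeasureSpace Ω] [IsProbabilityMeasure (ℙ : Measure Ω)]
    (G Gt : Ω → ℝ)
    (hG : Measure.map G ℙ = gaussianReal 0 1)
    (hGt : Measure.map Gt ℙ = gaussianReal 0 1)
    (hind : IndepFun G Gt ℙ)
    (α β γ s : ℝ) (hs : s = α ^ 2 + β ^ 2) (h : 0 < s) :
    ∫ ω, (G ω) ^ 2 * min (Real.exp (α * G ω + β * Gt ω + γ)) 1 ∂ℙ =
      (1 + α ^ 2) * Real.exp (γ + s / 2) * Phi (-(γ + s) / Real.sqrt s)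
        + Phi (γ / Real.sqrt s)
        - α ^ 2 / Real.sqrt (2 * Real.pi * s) * Real.exp (-γ ^ 2 / (2 * s)) := by
  have hGm : AEMeasurable G ℙ := .of_map_ne_zero (hG ▸ IsProbabilityMeasure.ne_zero _)
  have hGtm : AEMeasurable Gt ℙ := .of_map_ne_zero (hGt ▸ IsProbabilityMeasure.ne_zero _)
  have hlaw := hind.map_prod_eq_prod_map_map hGm hGtm
  rw [hG, hGt] at hlaw
  obtain ⟨r, hr, hrs⟩ : ∃ r : ℝ, 0 < r ∧ r ^ 2 = s :=
    ⟨Real.sqrt s, Real.sqrt_pos.mpr h, Real.sq_sqrt h.le⟩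
  obtain ⟨θ, hα, hβ⟩ : ∃ θ : ℝ, α = r * Real.cos θ ∧ β = -(r * Real.sin θ) := by
    have hnorm : ‖(⟨α, -β⟩ : ℂ)‖ = r := by
      rw [← sq_eq_sq₀ (norm_nonneg _) hr.le, Complex.sq_norm, Complex.normSq_mk, hrs, hs]
      ring
    refine ⟨Complex.arg ⟨α, -β⟩, ?_, ?_⟩
    · simpa [hnorm] using (Complex.norm_mul_cos_arg ⟨α, -β⟩).symm
    · rw [← hnorm, Complex.norm_mul_sin_arg]
      simp
  have hsqrt : Real.sqrt s = r := by rw [← hrs, Real.sqrt_sq hr.le]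
  calc
    _ = ∫ z : ℝ × ℝ, z.1 ^ 2 *
        min (Real.exp (r * Real.cos θ * z.1 - r * Real.sin θ * z.2 + γ)) 1
        ∂(gaussianReal 0 1).prod (gaussianReal 0 1) := by
      rw [← hlaw, integral_map (hGm.prodMk hGtm) (by fun_prop)]
      simp only [hα, hβ, neg_mul, sub_eq_add_neg]
    _ = _ := by
      rw [integral_sq_mul_min_exp_gaussianReal_prod, integral_sq_mul_min_exp_gaussianReal hr,
        integral_min_exp_gaussianReal hr, Real.sqrt_mul (by positivity : 0 ≤ 2 * Real.pi),
        hsqrt, hrs, hα, Real.sin_sq, div_pow, hrs]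
      have hexp : -(γ ^ 2 / s) / 2 = -γ ^ 2 / (2 * s) := by
        field_simp
      rw [hexp, ← hrs]
      field_simp
      ring
end

section
/- Let G be a standard normal random variable and let α, β ∈ ℝ. Then for every a ≥ 0, E[ 𝒢(a, αG + β) ] = 𝒢( a + l²α²/4, β ). -/
open MeasureTheory ProbabilityTheory

open scoped NNReal

lemma measurable_Gcal_zero (l : ℝ) : Measurable (Gcal l 0) := by
  have h : Gcal l 0 = fun b => if 0 < b then l ^ 2 * Real.exp (-(l ^ 2 * b) / 2) else 0 := by
    ext b; simp [Gcal]
  rw [h]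
  exact Measurable.ite measurableSet_Ioi (by fun_prop) measurable_const

lemma norm_Gcal_zero_le (l b : ℝ) : ‖Gcal l 0 b‖ ≤ l ^ 2 := by
  simp only [Gcal, lt_irrefl, if_false]
  split_ifs with hb
  · rw [Real.norm_of_nonneg (by positivity)]
    refine mul_le_of_le_one_right (sq_nonneg l) (Real.exp_le_one_iff.mpr ?_)
    have : 0 ≤ l ^ 2 * b := by positivity
    linarith
  · simpa using sq_nonneg l

lemma integrable_Gcal_zero (l : ℝ) (μ : Measure ℝ) [IsFiniteMeasure μ] :
    Integrable (Gcal l 0) μ :=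
  .of_bound (measurable_Gcal_zero l).aestronglyMeasurable (l ^ 2)
    (ae_of_all _ (norm_Gcal_zero_le l))

lemma Phi_eq_integral_Ioi {s : ℝ} (hs : 0 < s) (c : ℝ) :
    Phi c = (Real.sqrt (2 * Real.pi))⁻¹ *
      (s⁻¹ * ∫ x in Set.Ioi 0, Real.exp (-(c - x / s) ^ 2 / 2)) := by
  have hind : ∀ x : ℝ, (Set.Iic c).indicator (fun y => Real.exp (-y ^ 2 / 2)) (c - x / s)
      = (Set.Ici 0).indicator (fun x => Real.exp (-(c - x / s) ^ 2 / 2)) x := by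
    intro x
    have : c - x / s ∈ Set.Iic c ↔ x ∈ Set.Ici 0 := by
      simp only [Set.mem_Iic, Set.mem_Ici, sub_le_self_iff]
      exact ⟨fun h => by simpa [hs.ne'] using mul_nonneg h hs.le, fun h => div_nonneg h hs.le⟩
    simp only [Set.indicator, this]
  have hdiv := Measure.integral_comp_div
    (fun u => (Set.Iic c).indicator (fun y => Real.exp (-y ^ 2 / 2)) (c - u)) s
  rw [integral_sub_left_eq_self _ volume c] at hdiv
  simp only [hind] at hdiv
  rw [integral_indicator measurableSet_Ici, integral_indicator measurableSet_Iic,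
    integral_Ici_eq_integral_Ioi, abs_of_pos hs, smul_eq_mul] at hdiv
  rw [hdiv, inv_mul_cancel_left₀ hs.ne', Phi]

/-- `𝒢(a, ·)` is the Gaussian smoothing of `𝒢(0, ·)` with variance `4a / l²`. -/
lemma integral_Gcal_zero_gaussianReal {l : ℝ} (hl : 0 < l) (b : ℝ) (v : ℝ≥0) :
    ∫ x, Gcal l 0 x ∂(gaussianReal b v) = Gcal l (l ^ 2 * v / 4) b := by
  rcases eq_or_ne v 0 with rfl | hv
  · simp
  have hv0 : (0 : ℝ) < v := by positivity
  obtain ⟨s, hs, hsv⟩ : ∃ s : ℝ, 0 < s ∧ (v : ℝ) = s ^ 2 :=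
    ⟨√v, Real.sqrt_pos.mpr hv0, (Real.sq_sqrt hv0.le).symm⟩
  have hsqrt : √(l ^ 2 * (v : ℝ) / 4) = l * s / 2 := by
    rw [hsv, show l ^ 2 * s ^ 2 / 4 = (l * s / 2) ^ 2 by ring, Real.sqrt_sq (by positivity)]
  have hpos : 0 < l ^ 2 * (v : ℝ) / 4 := by positivity
  rw [integral_gaussianReal_eq_integral_smul hv, Gcal, if_pos hpos, hsqrt,
    Phi_eq_integral_Ioi hs]
  have hind : ∀ x : ℝ, gaussianPDFReal b v x • Gcal l 0 x =
      (Set.Ioi 0).indicator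
        (fun x => gaussianPDFReal b v x * (l ^ 2 * Real.exp (-(l ^ 2 * x) / 2))) x := by
    intro x
    simp [Gcal, Set.indicator]
  simp only [hind]
  rw [integral_indicator measurableSet_Ioi, ← integral_const_mul, ← integral_const_mul,
    ← integral_const_mul]
  congr 1 with x
  have hroot : √(2 * Real.pi * v) = √(2 * Real.pi) * s := by
    rw [hsv, Real.sqrt_mul (by positivity), Real.sqrt_sq hs.le]
  have hexp : Real.exp (-(x - b) ^ 2 / (2 * s ^ 2)) * Real.exp (-(l ^ 2 * x) / 2) =
      Real.exp (l ^ 2 * (l ^ 2 * s ^ 2 / 4 - b) / 2) *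
        Real.exp (-(l * (b / (2 * (l * s / 2)) - l * s / 2) - x / s) ^ 2 / 2) := by
    rw [← Real.exp_add, ← Real.exp_add]
    congr 1
    field_simp
    ring
  rw [gaussianPDFReal, hroot, mul_inv, hsv]
  linear_combination (√(2 * Real.pi))⁻¹ * s⁻¹ * l ^ 2 * hexp

lemma map_affine_gaussianReal (α β : ℝ) :
    (gaussianReal 0 1).map (fun x => α * x + β) = gaussianReal β (.mk (α ^ 2) (sq_nonneg α)) := by
  have h : (fun x : ℝ => α * x + β) = (fun x => x + β) ∘ (fun x => α * x) := rfl
  rw [h, ← Measure.map_map (by fun_prop) (by fun_prop), gaussianReal_map_const_mul,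
    gaussianReal_map_add_const]
  simp

theorem stmt_12 (l : ℝ) (hl : 0 < l)
    {Ω : Type*} [MeasureSpace Ω] [IsProbabilityMeasure (ℙ : Measure Ω)]
    (G : Ω → ℝ) (hG : Measure.map G ℙ = gaussianReal 0 1)
    (α β : ℝ) (a : ℝ) (ha : 0 ≤ a) :
    ∫ ω, Gcal l a (α * G ω + β) ∂ℙ = Gcal l (a + l ^ 2 * α ^ 2 / 4) β := by
  have hGm : AEMeasurable G ℙ := by
    refine AEMeasurable.of_map_ne_zero ?_
    rw [hG]
    exact IsProbabilityMeasure.ne_zero _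
  obtain ⟨v, hv⟩ : ∃ v : ℝ≥0, a = l ^ 2 * v / 4 :=
    ⟨.mk (4 * a / l ^ 2) (by positivity), by rw [NNReal.coe_mk]; field_simp⟩
  have hsmooth : ∀ y, Gcal l a y = ∫ x, Gcal l 0 (y + x) ∂(gaussianReal 0 v) := by
    intro y
    rw [hv, ← integral_Gcal_zero_gaussianReal hl,
      ← integral_map (φ := fun x => y + x) (by fun_prop)
        (measurable_Gcal_zero l).aestronglyMeasurable, gaussianReal_map_const_add, zero_add]
  have hmeas : StronglyMeasurable (Gcal l a) := by
    rw [funext hsmooth]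
    exact StronglyMeasurable.integral_prod_right
      ((measurable_Gcal_zero l).comp (measurable_fst.add measurable_snd)).stronglyMeasurable
  calc ∫ ω, Gcal l a (α * G ω + β) ∂ℙ
      = ∫ x, Gcal l a (α * x + β) ∂(gaussianReal 0 1) := by
        rw [← hG]
        exact (integral_map hGm (f := fun x => Gcal l a (α * x + β))
          (hmeas.comp_measurable (by fun_prop)).aestronglyMeasurable).symm
    _ = ∫ y, Gcal l a y ∂(gaussianReal β (.mk (α ^ 2) (sq_nonneg α))) := by
        rw [← map_affine_gaussianReal, integral_map (by fun_prop) hmeas.aestronglyMeasurable]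
    _ = ∫ x, Gcal l 0 x ∂(gaussianReal β (.mk (α ^ 2) (sq_nonneg α)) ∗ gaussianReal 0 v) := by
        rw [integral_conv (integrable_Gcal_zero l _)]
        simp only [hsmooth]
    _ = Gcal l (a + l ^ 2 * α ^ 2 / 4) β := by
        rw [gaussianReal_conv_gaussianReal, integral_Gcal_zero_gaussianReal hl, hv, add_zero]
        congr 1
        push_cast
        ring
end
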